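/- Let T be a subsystem of a Lie triple system S over a field F. Then S is a system of quotients of T if and only if S is a weak system of quotients of T satisfying C_T((T:s)) = 0 for every s ∈ S. -/

import Mathlib

/-- A Lie triple system structure on an `F`-vector space `S`:
a trilinear map `b` satisfying `[x,x,z] = 0`, the cyclic identity and the
Leibniz (derivation) identity. -/
structure LTSStruct (F : Type*) (S : Type*) [Field F] [AddCommGroup S] [Module F S] where
  b : S → S → S → S
  add₁ : ∀ x x' y z, b (x + x') y z = b x y z + b x' y z
  smul₁ : ∀ (c : F) (x y z : S), b (c • x) y z = c • b x y z
  add₂ : ∀ x y y' z, b x (y + y') z = b x y z + b x y' z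
  smul₂ : ∀ (c : F) (x y z : S), b x (c • y) z = c • b x y z
  add₃ : ∀ x y z z', b x y (z + z') = b x y z + b x y z'
  smul₃ : ∀ (c : F) (x y z : S), b x y (c • z) = c • b x y z
  alt : ∀ x z, b x x z = 0
  cyclic : ∀ x y z, b x y z + b y z x + b z x y = 0
  leibniz : ∀ u v x y z,
    b u v (b x y z) = b (b u v x) y z + b x (b u v y) z + b x y (b u v z)

namespace LTSStruct

variable {F : Type*} [Field F] {S : Type*} [AddCommGroup S] [Module F S]

/-- `I` is an ideal of the whole Lie triple system `S`: `[I,S,S] ⊆ I`. -/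
def IsIdeal (L : LTSStruct F S) (I : Submodule F S) : Prop :=
  ∀ x ∈ I, ∀ y z : S, L.b x y z ∈ I

/-- `T` is a subsystem of `S`: `[T,T,T] ⊆ T`. -/
def IsSubsystem (L : LTSStruct F S) (T : Submodule F S) : Prop :=
  ∀ x ∈ T, ∀ y ∈ T, ∀ z ∈ T, L.b x y z ∈ T

/-- `I` is an ideal of the subsystem `T`: `I ⊆ T` and `[I,T,T] ⊆ I`. -/
def IsIdealOf (L : LTSStruct F S) (I T : Submodule F S) : Prop :=
  I ≤ T ∧ ∀ x ∈ I, ∀ y ∈ T, ∀ z ∈ T, L.b x y z ∈ I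

/-- The centralizer of a subset `I` in the whole system `S`:
`C_S(I) = {x ∈ S : [x,I,S] = [S,I,x] = 0}`. -/
def centralizer (L : LTSStruct F S) (I : Set S) : Set S :=
  {x | (∀ i ∈ I, ∀ t : S, L.b x i t = 0) ∧ (∀ t : S, ∀ i ∈ I, L.b t i x = 0)}

/-- The centralizer of a subset `I` in a subsystem `T`:
`C_T(I) = {x ∈ T : [x,I,T] = [T,I,x] = 0}`. -/
def relCentralizer (L : LTSStruct F S) (T : Submodule F S) (I : Set S) : Set S :=
  {x | x ∈ T ∧ (∀ i ∈ I, ∀ t ∈ T, L.b x i t = 0) ∧ (∀ t ∈ T, ∀ i ∈ I, L.b t i x = 0)}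

/-- The center `C(S) = {x ∈ S : [x,S,S] = 0}`. -/
def center (L : LTSStruct F S) : Set S := {x | ∀ y z : S, L.b x y z = 0}

/-- The center of a subsystem `T`: `C(T) = {x ∈ T : [x,T,T] = 0}`. -/
def relCenter (L : LTSStruct F S) (T : Submodule F S) : Set S :=
  {x | x ∈ T ∧ ∀ y ∈ T, ∀ z ∈ T, L.b x y z = 0}

/-- `S` is semiprime: `[S,I,I] ≠ 0` for every nonzero ideal `I`. -/
def IsSemiprime (L : LTSStruct F S) : Prop :=
  ∀ I : Submodule F S, L.IsIdeal I → I ≠ ⊥ → ∃ t : S, ∃ i ∈ I, ∃ j ∈ I, L.b t i j ≠ 0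

/-- `S` is prime: `[S,I,J] ≠ 0` for all nonzero ideals `I`, `J`. -/
def IsPrime (L : LTSStruct F S) : Prop :=
  ∀ I J : Submodule F S, L.IsIdeal I → L.IsIdeal J → I ≠ ⊥ → J ≠ ⊥ →
    ∃ t : S, ∃ i ∈ I, ∃ j ∈ J, L.b t i j ≠ 0

/-- `S` is nondegenerate: `[S,x,x] ≠ 0` for every nonzero `x`. -/
def IsNondegenerate (L : LTSStruct F S) : Prop :=
  ∀ x : S, x ≠ 0 → ∃ t : S, L.b t x x ≠ 0

/-- A subsystem `T` is semiprime: `[T,I,I] ≠ 0` for every nonzero ideal `I` of `T`. -/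
def RelSemiprime (L : LTSStruct F S) (T : Submodule F S) : Prop :=
  ∀ I : Submodule F S, L.IsIdealOf I T → I ≠ ⊥ → ∃ t ∈ T, ∃ i ∈ I, ∃ j ∈ I, L.b t i j ≠ 0

/-- A subsystem `T` is prime: `[T,I,J] ≠ 0` for all nonzero ideals `I`, `J` of `T`. -/
def RelPrime (L : LTSStruct F S) (T : Submodule F S) : Prop :=
  ∀ I J : Submodule F S, L.IsIdealOf I T → L.IsIdealOf J T → I ≠ ⊥ → J ≠ ⊥ →
    ∃ t ∈ T, ∃ i ∈ I, ∃ j ∈ J, L.b t i j ≠ 0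

/-- A subsystem `T` is nondegenerate: `[T,x,x] ≠ 0` for every nonzero `x ∈ T`. -/
def RelNondegenerate (L : LTSStruct F S) (T : Submodule F S) : Prop :=
  ∀ x ∈ T, x ≠ 0 → ∃ t ∈ T, L.b t x x ≠ 0

/-- An ideal `I` of `S` is essential if it hits every nonzero ideal of `S`. -/
def IsEssentialIdeal (L : LTSStruct F S) (I : Submodule F S) : Prop :=
  L.IsIdeal I ∧ ∀ J : Submodule F S, L.IsIdeal J → J ≠ ⊥ → I ⊓ J ≠ ⊥

/-- An ideal `I` of the subsystem `T` is essential in `T` if it hits every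
nonzero ideal of `T`. -/
def IsEssentialIdealOf (L : LTSStruct F S) (I T : Submodule F S) : Prop :=
  L.IsIdealOf I T ∧ ∀ J : Submodule F S, L.IsIdealOf J T → J ≠ ⊥ → I ⊓ J ≠ ⊥

/-- The elements `s`, `R(x₁,y₁)⋯R(xₙ,yₙ)(s)` with all `xᵢ, yᵢ ∈ T`, where
`R(x,y)(z) = [z,x,y]`. -/
inductive InIter (L : LTSStruct F S) (T : Submodule F S) (s : S) : S → Prop
  | base : InIter L T s s
  | step (z x y : S) : InIter L T s z → x ∈ T → y ∈ T → InIter L T s (L.b z x y)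

/-- `_T(s)`: the linear span in `S` of `s` and all `R(x₁,y₁)⋯R(xₙ,yₙ)(s)`,
`xᵢ, yᵢ ∈ T`. -/
def innerIdeal (L : LTSStruct F S) (T : Submodule F S) (s : S) : Submodule F S :=
  Submodule.span F {z | InIter L T s z}

/-- `(T:s) = {x ∈ T : [x,T,_T(s)] + [x,_T(s),T] ⊆ T}`. -/
def quotSet (L : LTSStruct F S) (T : Submodule F S) (s : S) : Set S :=
  {x | x ∈ T ∧ ∀ t ∈ T, ∀ u ∈ L.innerIdeal T s, L.b x t u ∈ T ∧ L.b x u t ∈ T}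

/-- `S` is a system of quotients of `T`. -/
def IsSystemOfQuotients (L : LTSStruct F S) (T : Submodule F S) : Prop :=
  L.IsSubsystem T ∧ ∀ s s' : S, s ≠ 0 →
    ∃ x ∈ T, ∃ y ∈ T, L.b s x y ≠ 0 ∧ (x ∈ L.quotSet T s' ∨ y ∈ L.quotSet T s')

/-- `S` is a weak system of quotients of `T`. -/
def IsWeakSystemOfQuotients (L : LTSStruct F S) (T : Submodule F S) : Prop :=
  L.IsSubsystem T ∧ ∀ s : S, s ≠ 0 → ∃ x ∈ T, ∃ y ∈ T, L.b s x y ≠ 0 ∧ L.b s x y ∈ T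

/-- `S` is ideally absorbed into `T`: for every `0 ≠ s ∈ S` there is an ideal `I`
of `T` with `C_T(I) = 0` and `0 ≠ [s,I,T] + [s,T,I] ⊆ T`. -/
def IsIdeallyAbsorbed (L : LTSStruct F S) (T : Submodule F S) : Prop :=
  L.IsSubsystem T ∧ ∀ s : S, s ≠ 0 → ∃ I : Submodule F S, L.IsIdealOf I T ∧
    L.relCentralizer T (I : Set S) = {0} ∧
    (∃ i ∈ I, ∃ t ∈ T, L.b s i t ≠ 0 ∨ L.b s t i ≠ 0) ∧
    (∀ i ∈ I, ∀ t ∈ T, L.b s i t ∈ T ∧ L.b s t i ∈ T)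

end LTSStruct

namespace LTSStruct

variable {F : Type*} [Field F] {S : Type*} [AddCommGroup S] [Module F S]

theorem b_swap (L : LTSStruct F S) (x y z : S) : L.b x y z = -L.b y x z := by
  have h := L.alt (x + y) z
  rw [L.add₁, L.add₂, L.add₂, L.alt, L.alt, zero_add, add_zero] at h
  exact eq_neg_of_add_eq_zero_left h

theorem b_eq_sub (L : LTSStruct F S) (x y z : S) : L.b x y z = L.b z y x - L.b z x y := by
  have h := L.cyclic x y z
  rw [L.b_swap y z x] at h
  rw [← sub_eq_zero, ← h]
  abel

theorem b_zero₁ (L : LTSStruct F S) (y z : S) : L.b 0 y z = 0 := by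
  simpa using L.smul₁ 0 0 y z

theorem b_zero₂ (L : LTSStruct F S) (x z : S) : L.b x 0 z = 0 := by
  simpa using L.smul₂ 0 x 0 z

theorem b_zero₃ (L : LTSStruct F S) (x y : S) : L.b x y 0 = 0 := by
  simpa using L.smul₃ 0 x y 0

theorem b_mem_innerIdeal (L : LTSStruct F S) (T : Submodule F S) (s : S) {u x y : S}
    (hu : u ∈ L.innerIdeal T s) (hx : x ∈ T) (hy : y ∈ T) :
    L.b u x y ∈ L.innerIdeal T s := by
  unfold innerIdeal at hu ⊢
  induction hu using Submodule.span_induction with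
  | mem z hz => exact Submodule.subset_span (InIter.step z x y hz hx hy)
  | zero => rw [b_zero₁]; exact Submodule.zero_mem _
  | add v w _ _ hv hw => rw [L.add₁]; exact Submodule.add_mem _ hv hw
  | smul c v _ hv => rw [L.smul₁]; exact Submodule.smul_mem _ c hv

theorem self_mem_innerIdeal (L : LTSStruct F S) (T : Submodule F S) (s : S) :
    s ∈ L.innerIdeal T s :=
  Submodule.subset_span InIter.base

theorem b_mem_quotSet (L : LTSStruct F S) {T : Submodule F S} (hT : L.IsSubsystem T) (s : S)
    {a i b : S} (ha : a ∈ T) (hi : i ∈ L.quotSet T s) (hb : b ∈ T) :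
    L.b a i b ∈ L.quotSet T s := by
  obtain ⟨hiT, hi⟩ := hi
  have mem_mid : ∀ c ∈ T, ∀ u ∈ L.innerIdeal T s, L.b c i u ∈ T := fun c hc u hu ↦ by
    rw [L.b_swap]; exact T.neg_mem (hi c hc u hu).1
  have mem_left : ∀ u ∈ L.innerIdeal T s, ∀ c ∈ T, L.b u i c ∈ T := fun u hu c hc ↦ by
    rw [L.b_swap]; exact T.neg_mem (hi c hc u hu).2
  have mem_right : ∀ c ∈ T, ∀ u ∈ L.innerIdeal T s, L.b c u i ∈ T := fun c hc u hu ↦ by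
    rw [L.b_eq_sub]; exact T.sub_mem (hi c hc u hu).2 (hi c hc u hu).1
  have inner_mid : ∀ c ∈ T, ∀ u ∈ L.innerIdeal T s, ∀ d ∈ T,
      L.b c u d ∈ L.innerIdeal T s := fun c hc u hu d hd ↦ by
    rw [L.b_swap]; exact Submodule.neg_mem _ (L.b_mem_innerIdeal T s hu hc hd)
  have outer : ∀ c ∈ T, ∀ d ∈ T, ∀ u ∈ L.innerIdeal T s,
      L.b c u (L.b a i d) ∈ T := fun c hc d hd u hu ↦ by
    rw [L.leibniz]
    exact T.add_mem (T.add_mem (mem_left _ (inner_mid c hc u hu a ha) d hd)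
      (hT a ha _ (mem_right c hc u hu) d hd)) (mem_mid a ha _ (inner_mid c hc u hu d hd))
  refine ⟨hT a ha i hiT b hb, fun t ht u hu ↦ ?_⟩
  have hmid : L.b (L.b a i b) u t ∈ T := by
    have h := L.leibniz a i b u t
    have e : L.b (L.b a i b) u t
        = L.b a i (L.b b u t) - L.b b (L.b a i u) t - L.b b u (L.b a i t) := by
      rw [h]; abel
    rw [e]
    exact T.sub_mem (T.sub_mem (mem_mid a ha _ (inner_mid b hb u hu t ht))
      (hT b hb _ (mem_mid a ha u hu) t ht)) (outer b hb t ht u hu)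
  refine ⟨?_, hmid⟩
  have e : L.b (L.b a i b) t u = L.b (L.b a i b) u t - L.b t u (L.b a i b) := by
    rw [L.b_eq_sub t u]; abel
  rw [e]
  exact T.sub_mem hmid (outer t ht b hb u hu)

theorem IsSystemOfQuotients.isWeak {L : LTSStruct F S} {T : Submodule F S}
    (h : L.IsSystemOfQuotients T) : L.IsWeakSystemOfQuotients T := by
  refine ⟨h.1, fun s hs ↦ ?_⟩
  obtain ⟨x, hx, y, hy, hne, hxy⟩ := h.2 s s hs
  refine ⟨x, hx, y, hy, hne, ?_⟩
  have hs := L.self_mem_innerIdeal T s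
  rcases hxy with hq | hq
  · rw [L.b_swap]
    exact T.neg_mem (hq.2 y hy s hs).2
  · rw [L.b_eq_sub]
    exact T.sub_mem (hq.2 x hx s hs).1 (hq.2 x hx s hs).2

theorem IsSystemOfQuotients.relCentralizer_quotSet {L : LTSStruct F S} {T : Submodule F S}
    (h : L.IsSystemOfQuotients T) (s : S) : L.relCentralizer T (L.quotSet T s) = {0} := by
  ext z
  constructor
  · rintro ⟨-, h₁, h₂⟩
    by_contra hz
    obtain ⟨x, hx, y, hy, hne, hq | hq⟩ := h.2 z s hz
    · exact hne (h₁ x hq y hy)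
    · refine hne ?_
      rw [L.b_eq_sub, L.b_swap y x z, L.b_swap y z x, h₁ y hq x hx, h₂ x hx y hq]
      simp
  · rintro rfl
    exact ⟨T.zero_mem, fun _ _ _ _ ↦ L.b_zero₁ _ _, fun _ _ _ _ ↦ L.b_zero₃ _ _⟩

theorem IsWeakSystemOfQuotients.isSystemOfQuotients {L : LTSStruct F S} {T : Submodule F S}
    (h : L.IsWeakSystemOfQuotients T)
    (hC : ∀ s : S, L.relCentralizer T (L.quotSet T s) = {0}) : L.IsSystemOfQuotients T := by
  refine ⟨h.1, fun s s' hs ↦ ?_⟩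
  by_contra hcon
  have left_zero : ∀ i ∈ L.quotSet T s', ∀ t ∈ T, L.b s i t = 0 := fun i hi t ht ↦ by
    by_contra hne
    exact hcon ⟨i, hi.1, t, ht, hne, Or.inl hi⟩
  have right_zero : ∀ i ∈ L.quotSet T s', ∀ t ∈ T, L.b s t i = 0 := fun i hi t ht ↦ by
    by_contra hne
    exact hcon ⟨t, ht, i, hi.1, hne, Or.inr hi⟩
  have outer : ∀ i ∈ L.quotSet T s', ∀ u ∈ T, ∀ x ∈ T, ∀ y ∈ T,
      L.b u i (L.b s x y) = 0 := fun i hi u hu x hx y hy ↦ by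
    rw [L.leibniz, L.b_eq_sub u i s, left_zero i hi u hu, right_zero i hi u hu,
      left_zero _ (L.b_mem_quotSet h.1 s' hu hi hx) y hy,
      right_zero _ (L.b_mem_quotSet h.1 s' hu hi hy) x hx, sub_zero, b_zero₁]
    simp
  obtain ⟨x, hx, y, hy, hne, hmem⟩ := h.2 s hs
  have hz : L.b s x y ∈ L.relCentralizer T (L.quotSet T s') := by
    refine ⟨hmem, fun i hi u hu ↦ ?_, fun u hu i hi ↦ outer i hi u hu x hx y hy⟩
    have e := L.leibniz s x y i u
    rw [right_zero _ (L.b_mem_quotSet h.1 s' hy hi hu) x hx, right_zero i hi x hx,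
      b_zero₂, outer i hi y hy x hx u hu, add_zero, add_zero] at e
    exact e.symm
  rw [hC s'] at hz
  exact hne hz

end LTSStruct

/-- `S` is a system of quotients of `T` iff `S` is a weak system
of quotients of `T` with `C_T((T:s)) = 0` for every `s ∈ S`. -/
theorem isSystemOfQuotients_iff_weak_and_centralizers
    {F S : Type*} [Field F] [AddCommGroup S] [Module F S]
    (L : LTSStruct F S) (T : Submodule F S) (hT : L.IsSubsystem T) :
    L.IsSystemOfQuotients T ↔
      (L.IsWeakSystemOfQuotients T ∧
        ∀ s : S, L.relCentralizer T (L.quotSet T s) = {0}) := by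
  exact ⟨fun h ↦ ⟨h.isWeak, h.relCentralizer_quotSet⟩, fun h ↦ h.1.isSystemOfQuotients h.2⟩
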